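/- (Theorem 1) Let n ≥ 2, let π be any permutation of {1, …, n²}, and let x = (x₁, …, x_{n²})ᵀ ∈ ℤ^{n²} with 1 ≤ x_i ≤ n for i = 1, …, n² and A_π x <> 0. Then x = ½ (A_πᵀ sgn(A_π x) + (n+1)·1_{n²}); equivalently 2x = A_πᵀ sgn(A_π x) + (n+1)·1_{n²}, where 1_{n²} is the all-ones vector in ℤ^{n²}. -/

import Mathlib

open Matrix

/-- The difference matrix `A(n)`: rows are indexed by pairs `(i, j)` with `i < j`,
row `(i, j)` has entry `+1` in column `i`, entry `-1` in column `j`, and `0` elsewhere. -/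
def Amat (n : ℕ) : Matrix {p : Fin n × Fin n // p.1 < p.2} (Fin n) ℤ :=
  fun p k => if k = p.val.1 then 1 else if k = p.val.2 then -1 else 0

/-- The `(n·s(n)) × n²` block-diagonal matrix `A` with `n` copies of `A(n)` along the
diagonal and zeros elsewhere.  Columns are indexed by `Fin (n * n)` in the row-major
layout `(r, j) ↦ r·n + j` given by `finProdFinEquiv`. -/
def bigA (n : ℕ) : Matrix (Fin n × {p : Fin n × Fin n // p.1 < p.2}) (Fin (n * n)) ℤ :=
  fun r c =>
    if (finProdFinEquiv.symm c).1 = r.1 then Amat n r.2 (finProdFinEquiv.symm c).2 else 0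

/-- `A_π`: the matrix `A` with columns permuted by `π`, i.e. the `j`-th column of `A_π`
is the `π⁻¹(j)`-th column of `A`. -/
def Aperm (n : ℕ) (π : Equiv.Perm (Fin (n * n))) :
    Matrix (Fin n × {p : Fin n × Fin n // p.1 < p.2}) (Fin (n * n)) ℤ :=
  (bigA n).submatrix id ⇑π.symm

theorem Amat_mulVec (n : ℕ) (z : Fin n → ℤ) (p : {p : Fin n × Fin n // p.1 < p.2}) :
    (Amat n *ᵥ z) p = z p.val.1 - z p.val.2 := by
  have hne : p.val.2 ≠ p.val.1 := p.property.ne'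
  have h : ∀ k, Amat n p k * z k =
      (if k = p.val.1 then z k else 0) - (if k = p.val.2 then z k else 0) := by
    intro k
    unfold Amat
    split_ifs <;> simp_all
  simp [mulVec, dotProduct, h, Finset.sum_sub_distrib]

theorem Amat_transpose_mulVec_sign (n : ℕ) (z : Fin n → ℤ) (k : Fin n) :
    ((Amat n)ᵀ *ᵥ fun p => Int.sign ((Amat n *ᵥ z) p)) k = ∑ j, Int.sign (z k - z j) := by
  have h : ∀ i j : Fin n,
      (if i < j then (if k = i then 1 else if k = j then -1 else 0) * Int.sign (z i - z j) else 0) =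
        (if k = i then (if i < j then Int.sign (z i - z j) else 0) else 0) +
          (if k = j then (if i < j then Int.sign (z j - z i) else 0) else 0) := by
    intro i j
    rw [← neg_sub (z i) (z j), Int.sign_neg]
    split_ifs <;> simp_all
  calc ((Amat n)ᵀ *ᵥ fun p => Int.sign ((Amat n *ᵥ z) p)) k
      = ∑ p : {p : Fin n × Fin n // p.1 < p.2},
          (if k = p.val.1 then 1 else if k = p.val.2 then -1 else 0) *
            Int.sign (z p.val.1 - z p.val.2) := by
        simp only [Amat_mulVec]
        rfl
    _ = ∑ p : Fin n × Fin n, if p.1 < p.2 then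
          (if k = p.1 then 1 else if k = p.2 then -1 else 0) * Int.sign (z p.1 - z p.2) else 0 := by
        rw [← Finset.sum_filter]
        exact (Finset.sum_subtype _ (by simp) (fun p : Fin n × Fin n =>
          (if k = p.1 then 1 else if k = p.2 then -1 else 0) * Int.sign (z p.1 - z p.2))).symm
    _ = ∑ j, ((if k < j then Int.sign (z k - z j) else 0) +
          if j < k then Int.sign (z k - z j) else 0) := by
        rw [Fintype.sum_prod_type]
        simp only [h, Finset.sum_add_distrib]
        congr 1
        · rw [Finset.sum_comm]
          simp
        · simp
    _ = ∑ j, Int.sign (z k - z j) := by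
        refine Finset.sum_congr rfl fun j _ => ?_
        rcases lt_trichotomy k j with hkj | rfl | hkj
        · simp [hkj, hkj.not_gt]
        · simp
        · simp [hkj, hkj.not_gt]

theorem sum_Icc_sign_sub (n : ℕ) (w : ℤ) (h1 : 1 ≤ w) (hn : w ≤ n) :
    ∑ v ∈ Finset.Icc 1 (n : ℤ), Int.sign (w - v) = 2 * w - n - 1 := by
  have h : ∀ v : ℤ, Int.sign (w - v) = (if v < w then 1 else 0) - (if w < v then 1 else 0) := by
    intro v
    rcases lt_trichotomy v w with hv | rfl | hv
    · simp [hv, hv.not_gt, Int.sign_eq_one_of_pos (sub_pos.2 hv)]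
    · simp
    · simp [hv, hv.not_gt, Int.sign_eq_neg_one_of_neg (sub_neg.2 hv)]
  have hlt : (Finset.Icc 1 (n : ℤ)).filter (fun v => v < w) = Finset.Ico 1 w := by
    ext v
    simp only [Finset.mem_filter, Finset.mem_Icc, Finset.mem_Ico]
    omega
  have hgt : (Finset.Icc 1 (n : ℤ)).filter (fun v => w < v) = Finset.Ioc w n := by
    ext v
    simp only [Finset.mem_filter, Finset.mem_Icc, Finset.mem_Ioc]
    omega
  simp only [h, Finset.sum_sub_distrib, Finset.sum_boole, hlt, hgt, Int.card_Ico, Int.card_Ioc]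
  omega

theorem sum_sign_sub_of_injective (n : ℕ) (z : Fin n → ℤ) (hz : Function.Injective z)
    (hb : ∀ i, 1 ≤ z i ∧ z i ≤ (n : ℤ)) (k : Fin n) :
    ∑ j, Int.sign (z k - z j) = 2 * z k - n - 1 := by
  have himg : Finset.univ.image z = Finset.Icc 1 (n : ℤ) := by
    apply Finset.eq_of_subset_of_card_le
    · intro v hv
      obtain ⟨i, -, rfl⟩ := Finset.mem_image.1 hv
      exact Finset.mem_Icc.2 (hb i)
    · simp [Finset.card_image_of_injective _ hz]
  rw [← sum_Icc_sign_sub n (z k) (hb k).1 (hb k).2, ← himg, Finset.sum_image hz.injOn]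

theorem injective_of_Amat_mulVec_ne_zero (n : ℕ) (z : Fin n → ℤ)
    (hz : ∀ p, (Amat n *ᵥ z) p ≠ 0) : Function.Injective z := by
  intro i j hij
  by_contra hne
  rcases lt_or_gt_of_ne hne with h | h
  · exact hz ⟨(i, j), h⟩ (by simp [Amat_mulVec, hij])
  · exact hz ⟨(j, i), h⟩ (by simp [Amat_mulVec, hij])

theorem Aperm_mulVec (n : ℕ) (π : Equiv.Perm (Fin (n * n))) (x : Fin (n * n) → ℤ)
    (r : Fin n) (p : {p : Fin n × Fin n // p.1 < p.2}) :
    (Aperm n π *ᵥ x) (r, p) = (Amat n *ᵥ fun j => x (π (finProdFinEquiv (r, j)))) p := by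
  simp only [mulVec, dotProduct]
  rw [← (finProdFinEquiv.trans π).sum_comp, Fintype.sum_prod_type, Finset.sum_eq_single r]
  · simp [Aperm, bigA]
  · intro b _ hb
    simp [Aperm, bigA, hb]
  · simp

theorem Aperm_transpose_mulVec (n : ℕ) (π : Equiv.Perm (Fin (n * n)))
    (y : Fin n × {p : Fin n × Fin n // p.1 < p.2} → ℤ) (r k : Fin n) :
    ((Aperm n π)ᵀ *ᵥ y) (π (finProdFinEquiv (r, k))) =
      ((Amat n)ᵀ *ᵥ fun p => y (r, p)) k := by
  simp only [mulVec, dotProduct]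
  rw [Fintype.sum_prod_type, Finset.sum_eq_single r]
  · simp [Aperm, bigA]
  · intro b _ hb
    simp [Aperm, bigA, hb.symm]
  · simp

/-- Theorem 1: if `1 ≤ xᵢ ≤ n` for all `i` and `A_π x <> 0`, then
`2x = A_πᵀ sgn(A_π x) + (n+1)·1_{n²}`. -/
theorem two_smul_eq_Aperm_transpose_mulVec_sign (n : ℕ) (hn : 2 ≤ n)
    (π : Equiv.Perm (Fin (n * n))) (x : Fin (n * n) → ℤ)
    (hb : ∀ i, 1 ≤ x i ∧ x i ≤ (n : ℤ))
    (hx : ∀ p, (Aperm n π *ᵥ x) p ≠ 0) :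
    (2 : ℤ) • x =
      ((Aperm n π)ᵀ *ᵥ fun p => Int.sign ((Aperm n π *ᵥ x) p)) +
        ((n : ℤ) + 1) • (1 : Fin (n * n) → ℤ) := by
  ext c
  obtain ⟨⟨r, k⟩, rfl⟩ := (finProdFinEquiv.trans π).surjective c
  have hinj := injective_of_Amat_mulVec_ne_zero n (fun j => x (π (finProdFinEquiv (r, j))))
    fun p => Aperm_mulVec n π x r p ▸ hx (r, p)
  simp only [Equiv.trans_apply, Pi.add_apply, Pi.smul_apply, Pi.one_apply, smul_eq_mul,
    Aperm_transpose_mulVec, Aperm_mulVec, Amat_transpose_mulVec_sign]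
  rw [sum_sign_sub_of_injective n _ hinj fun j => hb _]
  ring
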